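/- Let p be an odd prime and n a positive integer. Every irreducible finite-dimensional complex representation (π, V) of the finite Heisenberg group H with nontrivial central character satisfies dim V = p^n. -/

import Mathlib

open scoped BigOperators

namespace RK

/-- The standard symplectic form `ω(v,w) = ∑ᵢ (vᵢ w_{n+i} - v_{n+i} wᵢ)`. -/
def ω {R : Type*} [CommRing R] {n : ℕ} (v w : Fin n ⊕ Fin n → R) : R :=
  ∑ i : Fin n, (v (Sum.inl i) * w (Sum.inr i) - v (Sum.inr i) * w (Sum.inl i))

lemma ω_add_left {R : Type*} [CommRing R] {n : ℕ} (u v w : Fin n ⊕ Fin n → R) :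
    ω (u + v) w = ω u w + ω v w := by
  simp only [ω, Pi.add_apply, ← Finset.sum_add_distrib]
  exact Finset.sum_congr rfl fun i _ => by ring

lemma ω_add_right {R : Type*} [CommRing R] {n : ℕ} (u v w : Fin n ⊕ Fin n → R) :
    ω u (v + w) = ω u v + ω u w := by
  simp only [ω, Pi.add_apply, ← Finset.sum_add_distrib]
  exact Finset.sum_congr rfl fun i _ => by ring

@[simp] lemma ω_zero_left {R : Type*} [CommRing R] {n : ℕ} (w : Fin n ⊕ Fin n → R) :
    ω 0 w = 0 := by simp [ω]

@[simp] lemma ω_zero_right {R : Type*} [CommRing R] {n : ℕ} (v : Fin n ⊕ Fin n → R) :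
    ω v 0 = 0 := by simp [ω]

@[simp] lemma ω_neg_left {R : Type*} [CommRing R] {n : ℕ} (v w : Fin n ⊕ Fin n → R) :
    ω (-v) w = - ω v w := by
  simp only [ω, Pi.neg_apply, ← Finset.sum_neg_distrib]
  exact Finset.sum_congr rfl fun i _ => by ring

@[simp] lemma ω_self {R : Type*} [CommRing R] {n : ℕ} (v : Fin n ⊕ Fin n → R) :
    ω v v = 0 := by simp [ω, mul_comm]

/-- `F_p^{2n}`, with coordinates indexed by `Fin n ⊕ Fin n`. -/
abbrev Vec (p n : ℕ) := Fin n ⊕ Fin n → ZMod p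

/-- The finite Heisenberg group `H = F_p^{2n} × F_p`. -/
@[ext]
structure Heis (p n : ℕ) where
  v : Vec p n
  t : ZMod p

/-- `ν = (p+1)/2`, the inverse of `2` mod `p`. -/
def ν (p : ℕ) : ZMod p := ((p + 1) / 2 : ℕ)

instance {p n : ℕ} : Mul (Heis p n) :=
  ⟨fun a b => ⟨a.v + b.v, a.t + b.t + ν p * ω a.v b.v⟩⟩
instance {p n : ℕ} : One (Heis p n) := ⟨⟨0, 0⟩⟩
instance {p n : ℕ} : Inv (Heis p n) := ⟨fun a => ⟨-a.v, -a.t⟩⟩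

lemma Heis.mul_def {p n : ℕ} (a b : Heis p n) :
    a * b = ⟨a.v + b.v, a.t + b.t + ν p * ω a.v b.v⟩ := rfl
lemma Heis.one_def {p n : ℕ} : (1 : Heis p n) = ⟨0, 0⟩ := rfl
lemma Heis.inv_def {p n : ℕ} (a : Heis p n) : a⁻¹ = ⟨-a.v, -a.t⟩ := rfl

instance {p n : ℕ} : Group (Heis p n) where
  mul := (· * ·)
  one := 1
  inv := Inv.inv
  mul_assoc a b c := by
    simp only [Heis.mul_def, ω_add_left, ω_add_right, Heis.mk.injEq]
    exact ⟨add_assoc _ _ _, by ring⟩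
  one_mul a := by simp [Heis.mul_def, Heis.one_def]
  mul_one a := by simp [Heis.mul_def, Heis.one_def]
  inv_mul_cancel a := by simp [Heis.mul_def, Heis.inv_def, Heis.one_def]

/-- The symplectic group `Sp(2n, F_p)`: invertible matrices preserving `ω`. -/
def Sp (p n : ℕ) : Subgroup ((Matrix (Fin n ⊕ Fin n) (Fin n ⊕ Fin n) (ZMod p))ˣ) where
  carrier := {A | ∀ v w : Vec p n, ω (A.val.mulVec v) (A.val.mulVec w) = ω v w}
  one_mem' := by
    intro v w
    simp [Matrix.one_mulVec]
  mul_mem' := by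
    intro A B hA hB v w
    simp only [Units.val_mul, ← Matrix.mulVec_mulVec]
    rw [hA, hB]
  inv_mem' := by
    intro A hA v w
    have h := hA (A⁻¹.val.mulVec v) (A⁻¹.val.mulVec w)
    rw [Matrix.mulVec_mulVec, Matrix.mulVec_mulVec, Units.mul_inv, Matrix.one_mulVec,
      Matrix.one_mulVec] at h
    exact h.symm

/-- The matrix underlying an element of `Sp(2n, F_p)`. -/
def Sp.mat {p n : ℕ} (A : Sp p n) : Matrix (Fin n ⊕ Fin n) (Fin n ⊕ Fin n) (ZMod p) :=
  (A : (Matrix (Fin n ⊕ Fin n) (Fin n ⊕ Fin n) (ZMod p))ˣ).val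

/-- The Egorov identity: `ρ(g) π(v,t) ρ(g)⁻¹ = π(gv, t)`. -/
def Egorov {p n : ℕ} {V : Type*} [AddCommGroup V] [Module ℂ V]
    (π : Representation ℂ (Heis p n) V) (ρ : Sp p n → (Module.End ℂ V)ˣ) : Prop :=
  ∀ (g : Sp p n) (v : Vec p n) (t : ZMod p),
    (ρ g : Module.End ℂ V) * π ⟨v, t⟩ * ((ρ g)⁻¹ : (Module.End ℂ V)ˣ) =
      π ⟨(Sp.mat g).mulVec v, t⟩

/-- Irreducibility of a representation: `V ≠ 0` and the only invariant subspaces are `⊥` and `⊤`. -/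
def IsIrreducibleRep {G : Type*} [Monoid G] {V : Type*} [AddCommGroup V] [Module ℂ V]
    (π : Representation ℂ G V) : Prop :=
  (∃ x : V, x ≠ 0) ∧
    ∀ W : Submodule ℂ V, (∀ (g : G) (x : V), x ∈ W → π g x ∈ W) → W = ⊥ ∨ W = ⊤

noncomputable instance {p n : ℕ} [NeZero p] : Fintype (Sp p n) := Fintype.ofFinite _

noncomputable instance {p n : ℕ} [NeZero p] (H : Subgroup (Sp p n)) : Fintype H :=
  Fintype.ofFinite _

end RK

namespace RK


lemma two_mul_ν {p : ℕ} [Fact p.Prime] (hp : p ≠ 2) : (2 : ZMod p) * ν p = 1 := by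
  have hodd : Odd p := (Fact.out : p.Prime).odd_of_ne_two hp
  obtain ⟨k, hk⟩ := hodd
  have h : 2 * ((p + 1) / 2) = p + 1 := by omega
  have h2 : ((2 * ((p + 1) / 2) : ℕ) : ZMod p) = ((p + 1 : ℕ) : ZMod p) := by rw [h]
  simpa [ν] using h2

lemma exists_ω_eq {p n : ℕ} [Fact p.Prime] (v : Vec p n) (hv : v ≠ 0) (s : ZMod p) :
    ∃ w : Vec p n, ω w v = s := by
  obtain ⟨k, hk⟩ := Function.ne_iff.mp hv
  simp only [Pi.zero_apply] at hk
  rcases k with k | k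
  · refine ⟨Pi.single (Sum.inr k) (-(s / v (Sum.inl k))), ?_⟩
    rw [ω, Finset.sum_eq_single k]
    · simp [hk]
    · intro b _ hb
      simp [Pi.single_apply, hb]
    · simp
  · refine ⟨Pi.single (Sum.inl k) (s / v (Sum.inr k)), ?_⟩
    rw [ω, Finset.sum_eq_single k]
    · simp [hk]
    · intro b _ hb
      simp [Pi.single_apply, hb]
    · simp

lemma ω_neg_right' {R : Type*} [CommRing R] {n : ℕ} (v w : Fin n ⊕ Fin n → R) :
    ω v (-w) = - ω v w := by
  have h := ω_add_right v w (-w)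
  simp only [add_neg_cancel, ω_zero_right] at h
  exact (neg_eq_of_add_eq_zero_right h.symm).symm

lemma ω_swap {R : Type*} [CommRing R] {n : ℕ} (v w : Fin n ⊕ Fin n → R) :
    ω v w = - ω w v := by
  simp only [ω, ← Finset.sum_neg_distrib]
  exact Finset.sum_congr rfl fun i _ => by ring

lemma conj_eq {p n : ℕ} [Fact p.Prime] (hp : p ≠ 2) (v w : Vec p n) (t : ZMod p) :
    (⟨w, 0⟩ : Heis p n) * ⟨v, t⟩ * (⟨w, 0⟩ : Heis p n)⁻¹ = ⟨0, ω w v⟩ * ⟨v, t⟩ := by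
  simp only [Heis.mul_def, Heis.inv_def, Heis.mk.injEq, ω_add_left, ω_neg_right', ω_self,
    ω_zero_left]
  refine ⟨by abel, ?_⟩
  rw [ω_swap v w]
  linear_combination (ω w v) * two_mul_ν hp

/-- The Heisenberg group as a product type. -/
def heisEquiv (p n : ℕ) : Heis p n ≃ Vec p n × ZMod p where
  toFun a := (a.v, a.t)
  invFun a := ⟨a.1, a.2⟩
  left_inv _ := rfl
  right_inv _ := rfl

/-- every irreducible representation of the finite Heisenberg group with a
nontrivial central character has dimension `p^n`. -/
theorem heisenberg_irrep_dim {p n : ℕ} [Fact p.Prime] (hp : p ≠ 2) (hn : 0 < n)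
    {V : Type*} [AddCommGroup V] [Module ℂ V] [FiniteDimensional ℂ V]
    (π : Representation ℂ (Heis p n) V) (hπ : IsIrreducibleRep π)
    (ψ : ZMod p → ℂ) (hψ : ∀ s : ZMod p, π ⟨0, s⟩ = ψ s • (1 : Module.End ℂ V))
    (hψnt : ∃ s, ψ s ≠ 1) :
    Module.finrank ℂ V = p ^ n := by
  classical
  obtain ⟨⟨x, hx⟩, hirr⟩ := hπ
  obtain ⟨s, hs⟩ := hψnt
  have hp0 : (p : ℂ) ≠ 0 := by exact_mod_cast (Fact.out : p.Prime).ne_zero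
  letI : Fintype (Heis p n) := Fintype.ofEquiv _ (heisEquiv p n).symm
  have hcard : Nat.card (Heis p n) = p ^ (2 * n + 1) := by
    rw [Nat.card_congr (heisEquiv p n)]
    simp [Nat.card_eq_fintype_card, ZMod.card, two_mul, pow_succ]
  have hcard0 : (Nat.card (Heis p n) : ℂ) ≠ 0 := by
    rw [hcard]; push_cast; exact pow_ne_zero _ hp0
  letI : Invertible (Nat.card (Heis p n) : ℂ) := invertibleOfNonzero hcard0
  haveI : Representation.IsIrreducible π :=
    { exists_pair_ne := ⟨⊥, ⊤, fun h => hx (by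
        have h1 : x ∈ (⊤ : Subrepresentation π) := by trivial
        rw [← h] at h1
        exact h1)⟩
      eq_bot_or_eq_top := fun W => by
        rcases hirr W.toSubmodule (fun g y hy => W.apply_mem_toSubmodule g hy) with h | h
        · left; exact Subrepresentation.toSubmodule_injective h
        · right; exact Subrepresentation.toSubmodule_injective h }
  have key := Representation.card_inv_mul_sum_char_mul_char_eq_finrank π π
  rw [Representation.IsIrreducible.finrank_intertwiningMap_self] at key
  -- vanishing off the center
  have hvan : ∀ (v : Vec p n) (t : ZMod p), v ≠ 0 → π.character ⟨v, t⟩ = 0 := by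
    intro v t hv
    obtain ⟨w, hw⟩ := exists_ω_eq v hv s
    have h1 := π.char_conj ⟨v, t⟩ ⟨w, 0⟩
    rw [conj_eq hp, hw, Representation.character, map_mul, hψ, smul_mul_assoc, one_mul,
      map_smul, smul_eq_mul] at h1
    change ψ s * π.character ⟨v, t⟩ = π.character ⟨v, t⟩ at h1
    have h2 : (ψ s - 1) * π.character ⟨v, t⟩ = 0 := by linear_combination h1
    exact (mul_eq_zero.mp h2).resolve_left (sub_ne_zero.mpr hs)
  have hcen : ∀ t : ZMod p, π.character ⟨0, t⟩ = ψ t * Module.finrank ℂ V := by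
    intro t
    rw [Representation.character, hψ, map_smul, smul_eq_mul, LinearMap.trace_one]
  have hψinv : ∀ t : ZMod p, ψ t * ψ (-t) = 1 := by
    intro t
    have h1 : π ⟨0, t⟩ * π ⟨0, -t⟩ = 1 := by
      rw [← map_mul, ← map_one π]
      congr 1
      simp [Heis.mul_def, Heis.one_def]
    rw [hψ, hψ] at h1
    have h2 := congrArg (fun f : Module.End ℂ V => f x) h1
    simp only [smul_mul_smul_comm, mul_one, LinearMap.smul_apply, Module.End.one_apply] at h2
    have h3 : (ψ t * ψ (-t) - 1) • x = 0 := by rw [sub_smul, h2, one_smul, sub_self]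
    exact sub_eq_zero.mp ((smul_eq_zero.mp h3).resolve_right hx)
  have hsum : ∑ g : Heis p n, π.character g * π.character g⁻¹
      = p * (Module.finrank ℂ V : ℂ) ^ 2 := by
    rw [← (heisEquiv p n).symm.sum_comp, Fintype.sum_prod_type, Finset.sum_eq_single 0]
    · have : ∀ t : ZMod p, π.character ((heisEquiv p n).symm (0, t)) *
          π.character ((heisEquiv p n).symm (0, t))⁻¹ = (Module.finrank ℂ V : ℂ) ^ 2 := by
        intro t
        have e : ((heisEquiv p n).symm (0, t))⁻¹ = ⟨0, -t⟩ := by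
          simp [heisEquiv, Heis.inv_def]
        rw [e, hcen]
        change π.character ⟨0, t⟩ * _ = _
        rw [hcen]
        linear_combination (Module.finrank ℂ V : ℂ) ^ 2 * hψinv t
      simp [this, ZMod.card]
    · intro v _ hv
      refine Finset.sum_eq_zero fun t _ => ?_
      change π.character ⟨v, t⟩ * _ = _
      rw [hvan v t hv, zero_mul]
    · simp
  rw [hsum, inv_mul_eq_iff_eq_mul₀ hcard0, hcard] at key
  push_cast at key
  have h4 : (Module.finrank ℂ V : ℂ) ^ 2 = ((p : ℂ) ^ n) ^ 2 := by
    apply mul_left_cancel₀ hp0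
    rw [key]; ring
  have h5 : (Module.finrank ℂ V) ^ 2 = (p ^ n) ^ 2 := by exact_mod_cast h4
  exact Nat.pow_left_injective two_ne_zero h5

end RK
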